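/- arXiv:1201.1315 — 2 statements merged into one kernel-verified Lean document; each statement's English description precedes it below -/
import Mathlib

section
/- Let p be an odd prime, let f : ℤ_p → ℚ_p be continuous, let n ≥ 1 be an integer, and let f_n(x) := f(x+n). Then the fermionic p-adic integrals I_{−1}(f_n) and I_{−1}(f) both exist and satisfy I_{−1}(f_n) + (−1)^{n−1}·I_{−1}(f) = 2·Σ_{x=0}^{n−1} (−1)^{n−1−x}·f(x). -/
open Filter

theorem sum_range_mul_eq_sum_sum {M : Type*} [AddCommMonoid M] (g : ℕ → M) (m k : ℕ) :
    ∑ x ∈ Finset.range (m * k), g x =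
      ∑ j ∈ Finset.range k, ∑ x ∈ Finset.range m, g (m * j + x) := by
  induction k with
  | zero => simp
  | succ k ih => rw [mul_add_one, Finset.sum_range_add, ih, Finset.sum_range_succ]

/-- For odd `m` and `k`, the alternating sum of `g` over `m * k` terms differs from the one over
`m` terms by an alternating sum of increments of `g` along multiples of `m`. -/
theorem alternating_sum_range_mul_sub {R : Type*} [CommRing R] (g : ℕ → R) {m k : ℕ}
    (hm : Odd m) (hk : Odd k) :
    ∑ x ∈ Finset.range (m * k), (-1) ^ x * g x - ∑ x ∈ Finset.range m, (-1) ^ x * g x =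
      ∑ j ∈ Finset.range k, ∑ x ∈ Finset.range m,
        (-1) ^ (j + x) * (g (m * j + x) - g x) := by
  have hgeom : ∑ j ∈ Finset.range k, (-1 : R) ^ j = 1 := by
    rw [neg_one_geom_sum, if_neg (Nat.not_even_iff_odd.2 hk)]
  have hsum : ∑ x ∈ Finset.range m, (-1) ^ x * g x =
      ∑ j ∈ Finset.range k, ∑ x ∈ Finset.range m, (-1) ^ (j + x) * g x := by
    simp_rw [pow_add, mul_assoc, ← Finset.mul_sum, ← Finset.sum_mul, hgeom, one_mul]
  rw [sum_range_mul_eq_sum_sum, hsum, ← Finset.sum_sub_distrib]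
  refine Finset.sum_congr rfl fun j _ => ?_
  rw [← Finset.sum_sub_distrib]
  refine Finset.sum_congr rfl fun x _ => ?_
  rw [pow_add, pow_mul, hm.neg_one_pow, pow_add, mul_sub]

theorem norm_neg_one_pow_mul {R : Type*} [NormedDivisionRing R] (n : ℕ) (a : R) :
    ‖(-1) ^ n * a‖ = ‖a‖ := by
  simp

theorem tendsto_natCast_prime_pow_padicInt (p : ℕ) [Fact p.Prime] :
    Tendsto (fun N : ℕ => ((p ^ N : ℕ) : ℤ_[p])) atTop (nhds 0) := by
  have hp : ‖(p : ℤ_[p])‖ < 1 := by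
    rw [PadicInt.norm_p]
    exact inv_lt_one_of_one_lt₀ (mod_cast (Fact.out : p.Prime).one_lt)
  simpa using tendsto_pow_atTop_nhds_zero_of_norm_lt_one hp

/-- The fermionic `p`-adic integral of a continuous function exists. -/
theorem exists_tendsto_fermionic_sum (p : ℕ) [Fact p.Prime] (hp : p ≠ 2)
    {f : ℤ_[p] → ℚ_[p]} (hf : Continuous f) :
    ∃ L : ℚ_[p], Tendsto
      (fun N : ℕ => ∑ x ∈ Finset.range (p ^ N), (-1 : ℚ_[p]) ^ x * f (x : ℤ_[p]))
      atTop (nhds L) := by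
  have hodd : Odd p := (Fact.out : p.Prime).odd_of_ne_two hp
  refine cauchySeq_tendsto_of_complete
    (NonarchimedeanAddGroup.cauchySeq_of_tendsto_sub_nhds_zero ?_)
  rw [Metric.tendsto_atTop]
  intro ε hε
  obtain ⟨δ, hδ, hfδ⟩ := Metric.uniformContinuous_iff.1
    (CompactSpace.uniformContinuous_of_continuous hf) (ε / 2) (half_pos hε)
  obtain ⟨N₀, hN₀⟩ := Metric.tendsto_atTop.1 (tendsto_natCast_prime_pow_padicInt p) δ hδ
  refine ⟨N₀, fun N hN => ?_⟩
  rw [dist_zero_right, pow_succ,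
    alternating_sum_range_mul_sub (fun x : ℕ => f (x : ℤ_[p])) hodd.pow hodd]
  refine lt_of_le_of_lt ?_ (half_lt_self hε)
  refine IsUltrametricDist.norm_sum_le_of_forall_le_of_nonneg (half_pos hε).le fun j _ => ?_
  refine IsUltrametricDist.norm_sum_le_of_forall_le_of_nonneg (half_pos hε).le fun x _ => ?_
  rw [norm_neg_one_pow_mul, ← dist_eq_norm]
  refine (hfδ ?_).le
  have hpow := hN₀ N hN
  rw [dist_zero_right] at hpow
  rw [dist_eq_norm]
  push_cast at hpow ⊢
  rw [add_sub_cancel_right, norm_mul]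
  exact (mul_le_of_le_one_right (norm_nonneg _) (PadicInt.norm_le_one _)).trans_lt hpow

theorem alternating_sum_range_shift {R : Type*} [CommRing R] (g : ℕ → R) (m : ℕ) :
    ∑ x ∈ Finset.range m, (-1) ^ x * g (x + 1) =
      g 0 - (-1) ^ m * g m - ∑ x ∈ Finset.range m, (-1) ^ x * g x := by
  induction m with
  | zero => simp
  | succ m ih => rw [Finset.sum_range_succ, Finset.sum_range_succ, ih]; ring

theorem tendsto_fermionic_sum_shift (p : ℕ) [Fact p.Prime] (hp : p ≠ 2)
    {f : ℤ_[p] → ℚ_[p]} (hf : Continuous f) {L : ℚ_[p]}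
    (hL : Tendsto (fun N : ℕ => ∑ x ∈ Finset.range (p ^ N), (-1 : ℚ_[p]) ^ x * f (x : ℤ_[p]))
      atTop (nhds L)) :
    Tendsto (fun N : ℕ => ∑ x ∈ Finset.range (p ^ N), (-1 : ℚ_[p]) ^ x * f ((x : ℤ_[p]) + 1))
      atTop (nhds (2 * f 0 - L)) := by
  have hodd : Odd p := (Fact.out : p.Prime).odd_of_ne_two hp
  have hend : Tendsto (fun N : ℕ => f ((p ^ N : ℕ) : ℤ_[p])) atTop (nhds (f 0)) :=
    (hf.tendsto 0).comp (tendsto_natCast_prime_pow_padicInt p)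
  rw [two_mul]
  refine ((hend.const_add (f 0)).sub hL).congr fun N => ?_
  have h := alternating_sum_range_shift (fun x : ℕ => f (x : ℤ_[p])) (p ^ N)
  rw [hodd.pow.neg_one_pow] at h
  simpa using h.symm

theorem tendsto_fermionic_sum_add_natCast (p : ℕ) [Fact p.Prime] (hp : p ≠ 2)
    {f : ℤ_[p] → ℚ_[p]} (hf : Continuous f) {L : ℚ_[p]}
    (hL : Tendsto (fun N : ℕ => ∑ x ∈ Finset.range (p ^ N), (-1 : ℚ_[p]) ^ x * f (x : ℤ_[p]))
      atTop (nhds L)) (n : ℕ) :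
    Tendsto (fun N : ℕ => ∑ x ∈ Finset.range (p ^ N),
        (-1 : ℚ_[p]) ^ x * f ((x : ℤ_[p]) + (n : ℤ_[p])))
      atTop (nhds ((-1) ^ n * L +
        2 * ∑ x ∈ Finset.range n, (-1 : ℚ_[p]) ^ (n - 1 - x) * f (x : ℤ_[p]))) := by
  induction n with
  | zero => simpa using hL
  | succ n ih =>
    have hcont : Continuous fun y : ℤ_[p] => f (y + (n : ℤ_[p])) := by fun_prop
    have hsign : ∑ x ∈ Finset.range n, (-1 : ℚ_[p]) ^ (n - x) * f (x : ℤ_[p]) =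
        -∑ x ∈ Finset.range n, (-1 : ℚ_[p]) ^ (n - 1 - x) * f (x : ℤ_[p]) := by
      rw [← Finset.sum_neg_distrib]
      refine Finset.sum_congr rfl fun x hx => ?_
      have hx' : n - x = n - 1 - x + 1 := by
        have := Finset.mem_range.1 hx
        omega
      rw [hx', pow_succ]
      ring
    convert tendsto_fermionic_sum_shift p hp hcont ih using 2
    · refine Finset.sum_congr rfl fun x _ => ?_
      push_cast
      rw [add_assoc, add_comm (1 : ℤ_[p])]
    · rw [Nat.add_sub_cancel, Finset.sum_range_succ, hsign, Nat.sub_self, zero_add]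
      ring

theorem fermionic_integral_general_functional_equation (p : ℕ) [Fact p.Prime]
    (hp : p ≠ 2) (f : ℤ_[p] → ℚ_[p]) (hf : Continuous f) (n : ℕ) (hn : 1 ≤ n) :
    ∃ Lₙ L : ℚ_[p],
      Filter.Tendsto
        (fun N : ℕ => ∑ x ∈ Finset.range (p ^ N),
          (-1 : ℚ_[p]) ^ x * f ((x : ℤ_[p]) + (n : ℤ_[p])))
        Filter.atTop (nhds Lₙ) ∧
      Filter.Tendsto
        (fun N : ℕ => ∑ x ∈ Finset.range (p ^ N), (-1 : ℚ_[p]) ^ x * f (x : ℤ_[p]))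
        Filter.atTop (nhds L) ∧
      Lₙ + (-1 : ℚ_[p]) ^ (n - 1) * L =
        2 * ∑ x ∈ Finset.range n, (-1 : ℚ_[p]) ^ (n - 1 - x) * f (x : ℤ_[p]) := by
  obtain ⟨L, hL⟩ := exists_tendsto_fermionic_sum p hp hf
  refine ⟨_, L, tendsto_fermionic_sum_add_natCast p hp hf hL n, hL, ?_⟩
  obtain ⟨m, rfl⟩ := Nat.exists_eq_add_of_le' hn
  rw [Nat.add_sub_cancel, pow_succ]
  ring
end

section
/- Let p be an odd prime, let c ∈ ℤ_p satisfy |c − 1|_p < 1, let x₀ ∈ ℚ_p, let d be an odd positive integer, and let χ be a Dirichlet character modulo d with values in ℚ_p (viewed as a d-periodic function χ : ℕ → ℚ_p vanishing on integers not coprime to d). Then for every n ∈ ℕ the limit lim_{N→∞} Σ_{x=0}^{d·p^N−1} (−1)^x · χ(x) · c^x · (x₀ + x)^n exists in ℚ_p and equals d^n · Σ_{j=0}^{d−1} (−1)^j · χ(j) · c^j · E_n((x₀ + j)/d, c^d). -/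
open Filter

theorem sum_range_mul_eq_sum_residues {M : Type*} [AddCommMonoid M] (f : ℕ → M) (d m : ℕ) :
    ∑ x ∈ Finset.range (d * m), f x =
      ∑ j ∈ Finset.range d, ∑ y ∈ Finset.range m, f (d * y + j) := by
  rw [Finset.sum_comm]
  induction m with
  | zero => simp
  | succ m ih => rw [Nat.mul_succ, Finset.sum_range_add, ih, Finset.sum_range_succ]

/-- Recursion for twisted power sums, by telescoping `q ^ x * (y + x) ^ n`. -/
theorem sub_one_mul_sum_pow_mul_add_pow {R : Type*} [CommRing R] (q y : R) (n m : ℕ) :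
    (q - 1) * ∑ x ∈ Finset.range m, q ^ x * (y + x) ^ n =
      q ^ m * (y + m) ^ n - y ^ n -
        q * ∑ k ∈ Finset.range n, n.choose k * ∑ x ∈ Finset.range m, q ^ x * (y + x) ^ k := by
  induction m with
  | zero => simp
  | succ m ih =>
    have h : (y + (m + 1 : R)) ^ n =
        ∑ k ∈ Finset.range n, (n.choose k : R) * (y + m) ^ k + (y + m) ^ n := by
      rw [← add_assoc, add_pow, Finset.sum_range_succ]
      simp [mul_comm]
    simp only [Finset.sum_range_succ _ m, mul_add, Finset.sum_add_distrib, ih]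
    have h2 : ∑ k ∈ Finset.range n, (n.choose k : R) * (q ^ m * (y + m) ^ k) =
        q ^ m * ∑ k ∈ Finset.range n, (n.choose k : R) * (y + m) ^ k := by
      rw [Finset.mul_sum]
      exact Finset.sum_congr rfl fun k _ => by ring
    rw [h2, Nat.cast_succ, h]
    ring

theorem PadicInt.tendsto_pow_prime_pow {p : ℕ} [Fact p.Prime] {c : ℤ_[p]} (hc : ‖c - 1‖ < 1) :
    Filter.Tendsto (fun N : ℕ => c ^ p ^ N) Filter.atTop (nhds 1) := by
  rw [tendsto_iff_norm_sub_tendsto_zero]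
  have hp1 : (1 : ℝ) < p := by exact_mod_cast (Fact.out : p.Prime).one_lt
  have h0 : Filter.Tendsto (fun N : ℕ => ((p : ℝ)⁻¹) ^ N) Filter.atTop (nhds 0) :=
    tendsto_pow_atTop_nhds_zero_of_lt_one (by positivity) (inv_lt_one_of_one_lt₀ hp1)
  refine squeeze_zero (fun _ => norm_nonneg _) (fun N => ?_) h0
  have h : (p : ℤ_[p]) ^ N ∣ c ^ p ^ N - 1 := by
    have := dvd_sub_pow_of_dvd_sub (PadicInt.norm_lt_one_iff_dvd _ |>.1 hc) N
    rw [one_pow] at this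
    exact (pow_dvd_pow _ N.le_succ).trans this
  rw [← Ideal.mem_span_singleton, ← PadicInt.norm_le_pow_iff_mem_span_pow] at h
  simpa using h

theorem Padic.tendsto_natCast_prime_pow (p : ℕ) [Fact p.Prime] :
    Filter.Tendsto (fun N : ℕ => ((p ^ N : ℕ) : ℚ_[p])) Filter.atTop (nhds 0) := by
  simp only [Nat.cast_pow]
  exact tendsto_pow_atTop_nhds_zero_of_norm_lt_one Padic.norm_p_lt_one

theorem PadicInt.add_one_ne_zero_of_norm_sub_one_lt {p : ℕ} [Fact p.Prime] (hp : p ≠ 2)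
    {c : ℤ_[p]} (hc : ‖c - 1‖ < 1) : c + 1 ≠ 0 := by
  intro h
  have h2 : c - 1 = -((2 : ℕ) : ℤ_[p]) := by push_cast; linear_combination h
  rw [h2, norm_neg, PadicInt.norm_natCast_lt_one_iff,
    Nat.prime_dvd_prime_iff_eq Fact.out Nat.prime_two] at hc
  exact hp hc

theorem PadicInt.exists_tendsto_fermionic_moment {p : ℕ} [Fact p.Prime] (hp : p ≠ 2)
    {c : ℤ_[p]} (hc : ‖c - 1‖ < 1) (y : ℚ_[p]) (n : ℕ) :
    ∃ L : ℚ_[p], Filter.Tendsto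
      (fun N : ℕ => ∑ x ∈ Finset.range (p ^ N),
        (-1 : ℚ_[p]) ^ x * (c : ℚ_[p]) ^ x * (y + (x : ℚ_[p])) ^ n)
      Filter.atTop (nhds L) := by
  simp only [← mul_pow (-1 : ℚ_[p])]
  set q : ℚ_[p] := -1 * (c : ℚ_[p]) with hq
  have hq1 : q - 1 ≠ 0 := by
    intro h
    apply PadicInt.add_one_ne_zero_of_norm_sub_one_lt hp hc
    apply Subtype.coe_injective
    push_cast
    linear_combination -h + hq
  have hqp : Filter.Tendsto (fun N : ℕ => q ^ p ^ N) Filter.atTop (nhds (-1)) := by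
    have h : Filter.Tendsto (fun N : ℕ => ((c ^ p ^ N : ℤ_[p]) : ℚ_[p])) Filter.atTop
        (nhds ((1 : ℤ_[p]) : ℚ_[p])) :=
      (continuous_subtype_val.tendsto _).comp (PadicInt.tendsto_pow_prime_pow hc)
    rw [PadicInt.coe_one] at h
    refine h.neg.congr fun N => ?_
    have hodd : Odd (p ^ N) := ((Fact.out : p.Prime).odd_of_ne_two hp).pow
    rw [hq, neg_one_mul, hodd.neg_pow, PadicInt.coe_pow]
  induction n using Nat.strong_induction_on with
  | _ n ih =>
    choose! L hL using ih
    refine ⟨(q - 1)⁻¹ * (-1 * (y + 0) ^ n - y ^ n -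
      q * ∑ k ∈ Finset.range n, n.choose k * L k), ?_⟩
    have key : ∀ N : ℕ, ∑ x ∈ Finset.range (p ^ N), q ^ x * (y + (x : ℚ_[p])) ^ n =
        (q - 1)⁻¹ * (q ^ p ^ N * (y + ((p ^ N : ℕ) : ℚ_[p])) ^ n - y ^ n -
          q * ∑ k ∈ Finset.range n, n.choose k *
            ∑ x ∈ Finset.range (p ^ N), q ^ x * (y + (x : ℚ_[p])) ^ k) := fun N => by
      rw [← sub_one_mul_sum_pow_mul_add_pow, inv_mul_cancel_left₀ hq1]
    simp only [key]
    refine (((hqp.mul ((tendsto_const_nhds.add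
      (Padic.tendsto_natCast_prime_pow p)).pow n)).sub_const _).sub
      (Filter.Tendsto.const_mul _ (tendsto_finsetSum _ fun k hk => ?_))).const_mul _
    exact (hL k (Finset.mem_range.1 hk)).const_mul _

theorem PadicInt.norm_pow_sub_one_lt {p : ℕ} [Fact p.Prime] {c : ℤ_[p]} (hc : ‖c - 1‖ < 1)
    (d : ℕ) : ‖c ^ d - 1‖ < 1 := by
  rw [PadicInt.norm_lt_one_iff_dvd] at hc ⊢
  exact hc.trans (sub_one_dvd_pow_sub_one c d)



theorem fermionic_moments_character_distribution_formula (p : ℕ) [Fact p.Prime]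
    (hp : p ≠ 2) (c : ℤ_[p]) (hc : ‖c - 1‖ < 1) (x₀ : ℚ_[p]) (d : ℕ) (hd : 0 < d)
    (hdo : Odd d) (χ : DirichletCharacter ℚ_[p] d) (n : ℕ) :
    ∃ (L : ℚ_[p]) (M : ℕ → ℚ_[p]),
      Filter.Tendsto
        (fun N : ℕ => ∑ x ∈ Finset.range (d * p ^ N),
          (-1 : ℚ_[p]) ^ x * χ (x : ZMod d) * ((c : ℚ_[p])) ^ x * (x₀ + (x : ℚ_[p])) ^ n)
        Filter.atTop (nhds L) ∧
      (∀ j : ℕ, j < d → Filter.Tendsto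
        (fun N : ℕ => ∑ x ∈ Finset.range (p ^ N),
          (-1 : ℚ_[p]) ^ x * (((c ^ d : ℤ_[p]) : ℚ_[p])) ^ x *
            ((x₀ + (j : ℚ_[p])) / (d : ℚ_[p]) + (x : ℚ_[p])) ^ n)
        Filter.atTop (nhds (M j))) ∧
      L = (d : ℚ_[p]) ^ n *
        ∑ j ∈ Finset.range d,
          (-1 : ℚ_[p]) ^ j * χ (j : ZMod d) * ((c : ℚ_[p])) ^ j * M j := by
  choose M hM using fun j : ℕ => PadicInt.exists_tendsto_fermionic_moment hp
    (PadicInt.norm_pow_sub_one_lt hc d) ((x₀ + j) / d) n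
  refine ⟨_, M, ?_, fun j _ => hM j, rfl⟩
  have hd0 : (d : ℚ_[p]) ≠ 0 := by exact_mod_cast hd.ne'
  have key : ∀ N : ℕ, ∑ x ∈ Finset.range (d * p ^ N),
      (-1 : ℚ_[p]) ^ x * χ (x : ZMod d) * (c : ℚ_[p]) ^ x * (x₀ + (x : ℚ_[p])) ^ n =
      (d : ℚ_[p]) ^ n * ∑ j ∈ Finset.range d,
        (-1 : ℚ_[p]) ^ j * χ (j : ZMod d) * (c : ℚ_[p]) ^ j *
          ∑ x ∈ Finset.range (p ^ N), (-1 : ℚ_[p]) ^ x * ((c ^ d : ℤ_[p]) : ℚ_[p]) ^ x *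
            ((x₀ + (j : ℚ_[p])) / (d : ℚ_[p]) + (x : ℚ_[p])) ^ n := fun N => by
    rw [sum_range_mul_eq_sum_residues]
    simp only [Finset.mul_sum]
    refine Finset.sum_congr rfl fun j _ => Finset.sum_congr rfl fun x _ => ?_
    have h1 : x₀ + ((d * x + j : ℕ) : ℚ_[p]) = d * ((x₀ + j) / d + x) := by
      push_cast
      field_simp
      ring
    have h2 : ((d * x + j : ℕ) : ZMod d) = j := by simp
    rw [h1, h2, mul_pow, pow_add, pow_mul, hdo.neg_one_pow, pow_add, pow_mul]
    push_cast
    ring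
  simp only [key]
  exact (tendsto_finsetSum _ fun j _ => (hM j).const_mul _).const_mul _
end
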